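/- arXiv:2208.10622 — 2 statements merged into one kernel-verified Lean document; each statement's English description precedes it below -/
import Mathlib

section
/- Let P ⊆ ℝ⁷ be an associative 3-plane. Then dim(P ∩ A) ≥ 1 if and only if dim(P ∩ A) = 1 or P = A. Equivalently, for an associative 3-plane P one never has dim(P ∩ A) = 2. -/
open Real

noncomputable section

/-- ℝ⁷ with its Euclidean structure. -/
abbrev E7 := EuclideanSpace ℝ (Fin 7)

/-- The standard orthonormal basis vectors of ℝ⁷ (0-indexed: `e 0` is e₁, ..., `e 6` is e₇). -/
def e (i : Fin 7) : E7 := EuclideanSpace.single i (1 : ℝ)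

/-- `trip i j k u v w` is `e^{i+1,j+1,k+1}(u,v,w)`: the determinant of the 3×3 matrix whose
columns are the (i,j,k)-coordinates of u, v, w. -/
def trip (i j k : Fin 7) (u v w : E7) : ℝ :=
  Matrix.det !![u i, v i, w i; u j, v j, w j; u k, v k, w k]

/-- The standard G₂ 3-form φ₀ = e^{123} + e^{145} + e^{167} + e^{246} − e^{257} − e^{347} − e^{356}. -/
def phi0 (u v w : E7) : ℝ :=
  trip 0 1 2 u v w + trip 0 3 4 u v w + trip 0 5 6 u v w + trip 1 3 5 u v w
    - trip 1 4 6 u v w - trip 2 3 6 u v w - trip 2 4 5 u v w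

/-- A 3-plane is associative if it is the span of an orthonormal triple (u₁,u₂,u₃) with
φ₀(u₁,u₂,u₃) = 1. -/
def IsAssociative (P : Submodule ℝ E7) : Prop :=
  ∃ u₁ u₂ u₃ : E7, Orthonormal ℝ ![u₁, u₂, u₃] ∧ phi0 u₁ u₂ u₃ = 1 ∧
    P = Submodule.span ℝ {u₁, u₂, u₃}

/-- The associative 3-plane A = span(e₁, e₂, e₃). -/
def A : Submodule ℝ E7 := Submodule.span ℝ {e 0, e 1, e 2}

/-- The cross product on ℝ⁷ determined by φ₀. -/
def cross (u v : E7) : E7 :=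
  !₂[(u 1 * v 2 - u 2 * v 1) + (u 3 * v 4 - u 4 * v 3) + (u 5 * v 6 - u 6 * v 5),
    (u 2 * v 0 - u 0 * v 2) + (u 3 * v 5 - u 5 * v 3) - (u 4 * v 6 - u 6 * v 4),
    (u 0 * v 1 - u 1 * v 0) - (u 3 * v 6 - u 6 * v 3) - (u 4 * v 5 - u 5 * v 4),
    (u 4 * v 0 - u 0 * v 4) + (u 5 * v 1 - u 1 * v 5) - (u 6 * v 2 - u 2 * v 6),
    (u 0 * v 3 - u 3 * v 0) - (u 6 * v 1 - u 1 * v 6) - (u 5 * v 2 - u 2 * v 5),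
    (u 6 * v 0 - u 0 * v 6) + (u 1 * v 3 - u 3 * v 1) - (u 2 * v 4 - u 4 * v 2),
    (u 0 * v 5 - u 5 * v 0) - (u 1 * v 4 - u 4 * v 1) - (u 2 * v 3 - u 3 * v 2)]

lemma inner_E7 (u v : E7) : inner ℝ u v = u 0 * v 0 + u 1 * v 1 + u 2 * v 2 + u 3 * v 3
    + u 4 * v 4 + u 5 * v 5 + u 6 * v 6 := by
  simp [PiLp.inner_apply, Fin.sum_univ_seven, mul_comm]

lemma inner_cross (u v w : E7) : inner ℝ (cross u v) w = phi0 u v w := by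
  rw [inner_E7]
  simp [cross, phi0, trip, Matrix.det_fin_three]
  ring

lemma phi0_cyc (u v w : E7) : phi0 u v w = phi0 v w u := by
  simp [phi0, trip, Matrix.det_fin_three]
  ring

lemma phi0_left (u v : E7) : phi0 u v u = 0 := by
  simp [phi0, trip, Matrix.det_fin_three]

lemma phi0_right (u v : E7) : phi0 u v v = 0 := by
  simp [phi0, trip, Matrix.det_fin_three]

lemma cross_sq (u v : E7) : inner ℝ (cross u v) (cross u v)
    = inner ℝ u u * inner ℝ v v - (inner ℝ u v : ℝ) ^ 2 := by
  simp only [inner_E7]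
  simp [cross]
  ring

lemma cross_comb (u v w : E7) (a b c a' b' c' : ℝ) :
    cross (a • u + b • v + c • w) (a' • u + b' • v + c' • w)
      = (b * c' - c * b') • cross v w + (c * a' - a * c') • cross w u
        + (a * b' - b * a') • cross u v := by
  ext i
  fin_cases i <;> simp [cross] <;> ring

lemma cross_eq (u v w : E7) (hu : inner ℝ u u = (1 : ℝ)) (hv : inner ℝ v v = (1 : ℝ))
    (hw : inner ℝ w w = (1 : ℝ)) (huv : inner ℝ u v = (0 : ℝ)) (h : phi0 u v w = 1) :
    cross u v = w := by
  have h1 := cross_sq u v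
  rw [hu, hv, huv] at h1
  have h2 := inner_cross u v w
  rw [h] at h2
  rw [← sub_eq_zero, ← inner_self_eq_zero (𝕜 := ℝ), inner_sub_left, inner_sub_right,
    inner_sub_right, h1, h2, real_inner_comm, h2, hw]
  norm_num

lemma mem_A (x : E7) : x ∈ A ↔ x 3 = 0 ∧ x 4 = 0 ∧ x 5 = 0 ∧ x 6 = 0 := by
  rw [A, Submodule.mem_span_triple]
  constructor
  · rintro ⟨a, b, c, rfl⟩
    simp [e]
  · rintro ⟨h3, h4, h5, h6⟩
    refine ⟨x 0, x 1, x 2, ?_⟩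
    ext i
    fin_cases i <;> simp [e, h3, h4, h5, h6]

lemma cross_mem_A (x y : E7) (hx : x ∈ A) (hy : y ∈ A) : cross x y ∈ A := by
  rw [mem_A] at *
  obtain ⟨h3, h4, h5, h6⟩ := hx
  obtain ⟨k3, k4, k5, k6⟩ := hy
  simp [cross, h3, h4, h5, h6, k3, k4, k5, k6]

lemma cross_mem_P (P : Submodule ℝ E7) (hP : IsAssociative P) (x y : E7) (hx : x ∈ P)
    (hy : y ∈ P) : cross x y ∈ P := by
  obtain ⟨u, v, w, ho, h, rfl⟩ := hP
  have hh := orthonormal_iff_ite.1 ho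
  have huu : inner ℝ u u = (1 : ℝ) := by simpa using hh 0 0
  have hvv : inner ℝ v v = (1 : ℝ) := by simpa using hh 1 1
  have hww : inner ℝ w w = (1 : ℝ) := by simpa using hh 2 2
  have huv : inner ℝ u v = (0 : ℝ) := by simpa using hh 0 1
  have hvw : inner ℝ v w = (0 : ℝ) := by simpa using hh 1 2
  have hwu : inner ℝ w u = (0 : ℝ) := by simpa using hh 2 0
  have h1 := phi0_cyc u v w
  have h2 := phi0_cyc v w u
  have e1 := cross_eq u v w huu hvv hww huv h
  have e2 := cross_eq v w u hvv hww huu hvw (by linarith)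
  have e3 := cross_eq w u v hww huu hvv hwu (by linarith)
  obtain ⟨a, b, c, rfl⟩ := Submodule.mem_span_triple.1 hx
  obtain ⟨a', b', c', rfl⟩ := Submodule.mem_span_triple.1 hy
  rw [cross_comb, e1, e2, e3]
  exact Submodule.mem_span_triple.2 ⟨_, _, _, rfl⟩

lemma finrank_P (P : Submodule ℝ E7) (hP : IsAssociative P) : Module.finrank ℝ P = 3 := by
  obtain ⟨u, v, w, ho, h, rfl⟩ := hP
  have := finrank_span_eq_card ho.linearIndependent
  have hr : Set.range ![u, v, w] = {u, v, w} := by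
    ext x
    simp [eq_comm]
    tauto
  rw [hr, Fintype.card_fin] at this
  exact this

lemma A_assoc : IsAssociative A := by
  refine ⟨e 0, e 1, e 2, ?_, ?_, rfl⟩
  · rw [orthonormal_iff_ite]
    intro i j
    fin_cases i <;> fin_cases j <;> simp [e, inner_E7]
  · simp [phi0, trip, e, Matrix.det_fin_three]

lemma not_two (P : Submodule ℝ E7) (hP : IsAssociative P) :
    Module.finrank ℝ ↥(P ⊓ A) ≠ 2 := by
  intro h2
  let b := (stdOrthonormalBasis ℝ ↥(P ⊓ A)).reindex (finCongr h2)
  have hh := orthonormal_iff_ite.1 b.orthonormal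
  have h00 : inner ℝ (b 0 : E7) (b 0 : E7) = (1 : ℝ) := (hh 0 0).trans (by simp)
  have h11 : inner ℝ (b 1 : E7) (b 1 : E7) = (1 : ℝ) := (hh 1 1).trans (by simp)
  have h01 : inner ℝ (b 0 : E7) (b 1 : E7) = (0 : ℝ) := (hh 0 1).trans (by simp)
  have hm : cross (b 0) (b 1) ∈ P ⊓ A :=
    ⟨cross_mem_P P hP _ _ (b 0).2.1 (b 1).2.1, cross_mem_A _ _ (b 0).2.2 (b 1).2.2⟩
  have hs := b.sum_repr' ⟨_, hm⟩
  have e0 : inner ℝ (b 0) ⟨_, hm⟩ = (0 : ℝ) := by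
    rw [Submodule.coe_inner, real_inner_comm, inner_cross, phi0_left]
  have e1 : inner ℝ (b 1) ⟨_, hm⟩ = (0 : ℝ) := by
    rw [Submodule.coe_inner, real_inner_comm, inner_cross, phi0_right]
  rw [Fin.sum_univ_two, e0, e1, zero_smul, zero_smul, add_zero] at hs
  have hz : cross (b 0) (b 1) = 0 := (congrArg Subtype.val hs).symm
  have hq := cross_sq (b 0) (b 1)
  rw [h00, h11, h01, hz, inner_zero_left] at hq
  norm_num at hq

/-- For an associative 3-plane P: dim(P ∩ A) ≥ 1 iff dim(P ∩ A) = 1 or P = A; equivalently,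
dim(P ∩ A) is never 2. -/
theorem statement3 (P : Submodule ℝ E7) (hP : IsAssociative P) :
    (1 ≤ Module.finrank ℝ ↥(P ⊓ A) ↔ Module.finrank ℝ ↥(P ⊓ A) = 1 ∨ P = A) ∧
      Module.finrank ℝ ↥(P ⊓ A) ≠ 2 := by
  have hn := not_two P hP
  refine ⟨⟨fun h => ?_, ?_⟩, hn⟩
  · by_cases h1 : Module.finrank ℝ ↥(P ⊓ A) = 1
    · exact Or.inl h1
    · right
      have hp := finrank_P P hP
      have ha := finrank_P A A_assoc
      have i1 := Submodule.eq_of_le_of_finrank_le (inf_le_left : P ⊓ A ≤ P) (by omega)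
      have i2 := Submodule.eq_of_le_of_finrank_le (inf_le_right : P ⊓ A ≤ A) (by omega)
      exact i1.symm.trans i2
  · rintro (h | rfl)
    · omega
    · rw [inf_idem, finrank_P _ hP]
      norm_num
end
end

section
/- Let ω₁ := e^{23} + e^{45} + e^{67} and let Υ be the alternating ℝ-trilinear map from ℝ⁷ to ℂ given by Υ(v₁,v₂,v₃) = det of the 3×3 complex matrix with entries z_k(v_j), where z₁(v) = v₂ + i·v₃, z₂(v) = v₄ + i·v₅, z₃(v) = v₆ + i·v₇ (so Υ = (e² + ie³) ∧ (e⁴ + ie⁵) ∧ (e⁶ + ie⁷)). Suppose u₁, u₂, u₃ ∈ ℝ⁷ are orthonormal, each orthogonal to e₁, with ω₁(u_i, u_j) = 0 for all i, j, and Im Υ(u₁,u₂,u₃) = 0. Then φ₀(u₁,u₂,u₃) = 1 or φ₀(u₁,u₂,u₃) = −1; in particular span(u₁,u₂,u₃) is an associative 3-plane. -/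
open Real

noncomputable section

open scoped RealInnerProductSpace

/-- The 2-form ω₁ = e^{23} + e^{45} + e^{67}. -/
def omega1 (u v : E7) : ℝ :=
  (u 1 * v 2 - u 2 * v 1) + (u 3 * v 4 - u 4 * v 3) + (u 5 * v 6 - u 6 * v 5)

/-- The complex coordinates z₁ = e² + ie³, z₂ = e⁴ + ie⁵, z₃ = e⁶ + ie⁷. -/
def zc1 (v : E7) : ℂ := (v 1 : ℂ) + (v 2 : ℂ) * Complex.I
def zc2 (v : E7) : ℂ := (v 3 : ℂ) + (v 4 : ℂ) * Complex.I
def zc3 (v : E7) : ℂ := (v 5 : ℂ) + (v 6 : ℂ) * Complex.I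

/-- The complex volume form Υ = (e² + ie³) ∧ (e⁴ + ie⁵) ∧ (e⁶ + ie⁷). -/
def Ups (u v w : E7) : ℂ :=
  Matrix.det !![zc1 u, zc1 v, zc1 w; zc2 u, zc2 v, zc2 w; zc3 u, zc3 v, zc3 w]

lemma inner7 (u v : E7) : ⟪u, v⟫ = u 0 * v 0 + u 1 * v 1 + u 2 * v 2 + u 3 * v 3 + u 4 * v 4
    + u 5 * v 5 + u 6 * v 6 := by
  simp [PiLp.inner_apply, Fin.sum_univ_succ]
  ring

lemma entry_eq (u v : E7) (c : ℝ) (hu : u 0 = 0) (hi : ⟪u, v⟫ = c) (ho : omega1 u v = 0) :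
    star (zc1 u) * zc1 v + star (zc2 u) * zc2 v + star (zc3 u) * zc3 v = (c : ℂ) := by
  rw [inner7, hu] at hi
  unfold omega1 at ho
  apply Complex.ext
  · simp [zc1, zc2, zc3]
    linarith
  · simp [zc1, zc2, zc3]
    linarith

lemma phi0_eq (u v w : E7) (hu : u 0 = 0) (hv : v 0 = 0) (hw : w 0 = 0) :
    phi0 u v w = (Ups u v w).re := by
  simp [phi0, trip, Ups, Matrix.det_fin_three, zc1, zc2, zc3, hu, hv, hw]
  ring

lemma phi0_swap (u v w : E7) : phi0 v u w = - phi0 u v w := by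
  simp only [phi0, trip, Matrix.det_fin_three, Matrix.of_apply, Matrix.cons_val', Matrix.cons_val]
  ring

/-- Special Legendrian triples are associative: an orthonormal triple orthogonal to e₁ on which
ω₁ vanishes and Im Υ = 0 satisfies φ₀ = ±1, so its span is an associative 3-plane. -/
theorem statement10 (u₁ u₂ u₃ : E7)
    (horth : Orthonormal ℝ ![u₁, u₂, u₃])
    (hperp : ∀ i : Fin 3, ⟪e 0, ![u₁, u₂, u₃] i⟫ = 0)
    (homega : ∀ i j : Fin 3, omega1 (![u₁, u₂, u₃] i) (![u₁, u₂, u₃] j) = 0)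
    (him : (Ups u₁ u₂ u₃).im = 0) :
    (phi0 u₁ u₂ u₃ = 1 ∨ phi0 u₁ u₂ u₃ = -1) ∧
      IsAssociative (Submodule.span ℝ {u₁, u₂, u₃}) := by
  have hz : ∀ i : Fin 3, (![u₁, u₂, u₃] i) 0 = 0 := by
    intro i
    have := hperp i
    rw [inner7] at this
    simpa [e] using this
  have key : ∀ i j : Fin 3, _ := fun i j =>
    entry_eq _ _ _ (hz i) (orthonormal_iff_ite.mp horth i j) (homega i j)
  have hdet : star (Ups u₁ u₂ u₃) * Ups u₁ u₂ u₃ = 1 := by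
    unfold Ups
    rw [← Matrix.det_conjTranspose, ← Matrix.det_mul]
    convert Matrix.det_one (n := Fin 3) (R := ℂ)
    ext i j
    have h := key i j
    fin_cases i <;> fin_cases j <;>
      simpa [Matrix.mul_apply, Fin.sum_univ_three, Matrix.one_apply] using h
  have hphi : phi0 u₁ u₂ u₃ = (Ups u₁ u₂ u₃).re :=
    phi0_eq _ _ _ (hz 0) (hz 1) (hz 2)
  have hor : phi0 u₁ u₂ u₃ = 1 ∨ phi0 u₁ u₂ u₃ = -1 := by
    have h := congrArg Complex.re hdet
    simp [him] at h
    rw [hphi]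
    exact mul_self_eq_one_iff.mp h
  refine ⟨hor, ?_⟩
  rcases hor with h | h
  · exact ⟨u₁, u₂, u₃, horth, h, rfl⟩
  · refine ⟨u₂, u₁, u₃, ?_, by rw [phi0_swap, h, neg_neg], by rw [Set.insert_comm]⟩
    have h2 := horth.comp (Equiv.swap (0 : Fin 3) 1) (Equiv.injective _)
    convert h2 using 1
    funext i
    fin_cases i <;> rfl
end
end
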